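/- arXiv:2604.25970 — 2 statements merged into one kernel-verified Lean document; each statement's English description precedes it below -/
import Mathlib

section
/- For each m ≥ 1 let A_m(z) = ∑_{k=0}^{m−1} ⟨m, k⟩ z^k be the Eulerian polynomial of type A, where ⟨m, k⟩ is the number of permutations of {0, …, m−1} with exactly k descents. Suppose that for each n ≥ 2 there exists a_n > 0 with A_{2n}(−a_n) = 0, a_n ≤ a for every a > 0 with A_{2n}(−a) = 0, and such that A_{2n} splits over ℝ with all zeros negative. Then (1/(n−1)) · log a_n → −log 4 as n → ∞. -/
open Polynomial Filter

open scoped Classical in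
/-- The Eulerian polynomial of type A: `A_m(z) = ∑_{k=0}^{m−1} ⟨m,k⟩ z^k`, where
`⟨m,k⟩` counts permutations of `Fin m` with exactly `k` descents (indices `i` with
`i+1 < m` and `σ i > σ (i+1)`). -/
noncomputable def eulerianA (m : ℕ) : Polynomial ℝ :=
  ∑ k ∈ Finset.range m,
    Polynomial.C
      ((Finset.univ.filter (fun σ : Equiv.Perm (Fin m) =>
        (Finset.univ.filter (fun i : Fin m =>
          ∃ h : (i : ℕ) + 1 < m, σ ⟨(i : ℕ) + 1, h⟩ < σ i)).card = k)).card : ℝ) *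
      Polynomial.X ^ k

open scoped Classical in
/-- The set of descents of a permutation of `Fin m`. -/
noncomputable def descents {m : ℕ} (σ : Equiv.Perm (Fin m)) : Finset (Fin m) :=
  Finset.univ.filter (fun i : Fin m => ∃ h : (i : ℕ) + 1 < m, σ ⟨(i : ℕ) + 1, h⟩ < σ i)

lemma mem_descents {m : ℕ} {σ : Equiv.Perm (Fin m)} {i : Fin m} :
    i ∈ descents σ ↔ ∃ h : (i : ℕ) + 1 < m, σ ⟨(i : ℕ) + 1, h⟩ < σ i := by
  simp [descents]

/-- The Eulerian number `⟨m, k⟩`. -/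
noncomputable def eulerianNumber (m k : ℕ) : ℕ :=
  (Finset.univ.filter (fun σ : Equiv.Perm (Fin m) => (descents σ).card = k)).card

lemma coeff_eulerianA {m k : ℕ} (hk : k < m) :
    (eulerianA m).coeff k = eulerianNumber m k := by
  simp only [eulerianA, finsetSum_coeff, coeff_C_mul, coeff_X_pow]
  rw [Finset.sum_eq_single k]
  · simp only [if_true, mul_one, eulerianNumber, descents]
    congr!
  · intro b _ hb
    simp [hb.symm]
  · simp [hk]

lemma natDegree_eulerianA_le (m : ℕ) : (eulerianA m).natDegree ≤ m := by
  refine natDegree_sum_le_of_forall_le _ _ fun k hk => ?_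
  exact (natDegree_C_mul_X_pow_le _ _).trans (Finset.mem_range.1 hk).le

/-- `σ i < σ j` whenever `i < j` and `σ` has no descent in `[i, j)`. -/
lemma lt_of_forall_notMem_descents {m : ℕ} {σ : Equiv.Perm (Fin m)} {i j : Fin m} (hij : i < j)
    (h : ∀ k, i ≤ k → k < j → k ∉ descents σ) : σ i < σ j := by
  obtain ⟨j, hj⟩ := j
  induction j with
  | zero => exact absurd hij (by simp [Fin.lt_def])
  | succ j ih =>
    have hj' : j < m := by omega
    have hle : (i : ℕ) ≤ j := by simpa [Fin.lt_def, Nat.lt_succ_iff] using hij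
    have hstep : σ ⟨j, hj'⟩ < σ ⟨j + 1, hj⟩ := by
      have h1 := h ⟨j, hj'⟩ hle (by simp [Fin.lt_def])
      rw [mem_descents] at h1
      push Not at h1
      refine lt_of_le_of_ne (h1 hj) fun he => ?_
      simpa using σ.injective he
    rcases hle.eq_or_lt with he | hlt
    · have : i = ⟨j, hj'⟩ := Fin.ext he
      rwa [this]
    · exact (ih hj' hlt fun k hk hkj => h k hk (hkj.trans (by simp [Fin.lt_def]))).trans hstep

lemma eulerianNumber_zero (m : ℕ) : eulerianNumber m 0 = 1 := by
  rw [eulerianNumber, Finset.card_eq_one]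
  refine ⟨1, Finset.ext fun σ => ?_⟩
  simp only [Finset.mem_filter, Finset.mem_univ, true_and, Finset.mem_singleton,
    Finset.card_eq_zero]
  constructor
  · intro h
    have hσ : StrictMono σ := fun i j hij =>
      lt_of_forall_notMem_descents hij (by simp [h])
    have := (StrictMono.range_inj hσ strictMono_id).1 (by simp [σ.surjective.range_eq])
    exact Equiv.ext (congrFun this)
  · rintro rfl
    refine Finset.eq_empty_of_forall_notMem fun i hi => ?_
    obtain ⟨h, hlt⟩ := mem_descents.1 hi
    simp [Fin.lt_def] at hlt

/-- A permutation with a single descent `i` is determined by the image of `{0, …, i}`. -/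
lemma eq_of_descents_eq_singleton {m : ℕ} {σ τ : Equiv.Perm (Fin m)} {i j : Fin m}
    (hσ : descents σ = {i}) (hτ : descents τ = {j})
    (h : (Finset.Iic i).map σ.toEmbedding = (Finset.Iic j).map τ.toEmbedding) : σ = τ := by
  have hij : i = j := by
    have := congrArg Finset.card h
    simp only [Finset.card_map, Fin.card_Iic] at this
    exact Fin.ext (by omega)
  subst hij
  have hmem : ∀ x, (∃ k ≤ i, σ k = x) ↔ ∃ k ≤ i, τ k = x := fun x => by
    simpa only [Finset.mem_map, Finset.mem_Iic, Equiv.coe_toEmbedding] using Finset.ext_iff.1 h x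
  have hmem' : ∀ x, (∃ k, i < k ∧ σ k = x) ↔ ∃ k, i < k ∧ τ k = x := fun x => by
    have hs : ∀ ρ : Equiv.Perm (Fin m), (∃ k, i < k ∧ ρ k = x) ↔ ¬ ∃ k ≤ i, ρ k = x := by
      intro ρ
      constructor
      · rintro ⟨k, hk, rfl⟩ ⟨l, hl, he⟩
        exact absurd (ρ.injective he ▸ hl) (not_le.2 hk)
      · intro hn
        refine ⟨ρ.symm x, ?_, by simp⟩
        by_contra hc
        exact hn ⟨_, not_lt.1 hc, by simp⟩
    rw [hs, hs, hmem]
  have mono_low : ∀ ρ : Equiv.Perm (Fin m), descents ρ = {i} →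
      StrictMono fun k : {k // k ≤ i} => ρ k := fun ρ hρ k l hkl =>
    lt_of_forall_notMem_descents hkl fun x _ hx => by
      rw [hρ, Finset.mem_singleton]
      exact (hx.trans_le l.2).ne
  have mono_high : ∀ ρ : Equiv.Perm (Fin m), descents ρ = {i} →
      StrictMono fun k : {k // i < k} => ρ k := fun ρ hρ k l hkl =>
    lt_of_forall_notMem_descents hkl fun x hx _ => by
      rw [hρ, Finset.mem_singleton]
      exact (k.2.trans_le hx).ne'
  have low := (StrictMono.range_inj (mono_low σ hσ) (mono_low τ hτ)).1 (by
    ext x; simpa using hmem x)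
  have high := (StrictMono.range_inj (mono_high σ hσ) (mono_high τ hτ)).1 (by
    ext x; simpa using hmem' x)
  refine Equiv.ext fun k => ?_
  rcases le_or_gt k i with hk | hk
  · exact congrFun low ⟨k, hk⟩
  · exact congrFun high ⟨k, hk⟩

lemma eulerianNumber_one_le (m : ℕ) : eulerianNumber m 1 ≤ 2 ^ m := by
  have hex : ∀ σ ∈ Finset.univ.filter (fun σ : Equiv.Perm (Fin m) => (descents σ).card = 1),
      ∃ S : Finset (Fin m), ∃ i, descents σ = {i} ∧ (Finset.Iic i).map σ.toEmbedding = S := by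
    intro σ hσ
    obtain ⟨i, hi⟩ := Finset.card_eq_one.1 (Finset.mem_filter.1 hσ).2
    exact ⟨_, i, hi, rfl⟩
  choose! f hf using hex
  have := Finset.card_le_card_of_injOn (t := Finset.univ) f (by simp) (by
    intro σ hσ τ hτ he
    obtain ⟨i, hi, hi'⟩ := hf σ hσ
    obtain ⟨j, hj, hj'⟩ := hf τ hτ
    exact eq_of_descents_eq_singleton hi hj (by rw [hi', hj', he]))
  simpa [eulerianNumber] using this

/-- Every subset of `Fin m` is the image of an initial segment under a permutation with at most
one descent. -/
lemma exists_perm_descents_card_le_one {m : ℕ} (S : Finset (Fin m)) :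
    ∃ σ : Equiv.Perm (Fin m), (descents σ).card ≤ 1 ∧
      ∃ k ≤ m, ∀ j, σ j ∈ S ↔ (j : ℕ) < k := by
  classical
  let f : Fin m → ℕ := fun j => (if j ∈ S then 0 else m) + j
  have hmem : ∀ {x y}, f x ≤ f y → y ∈ S → x ∈ S := by
    intro x y h hy
    by_contra hx
    simp only [f, hx, hy, if_true, if_false] at h
    omega
  let σ := Tuple.sort f
  have hmono : Monotone (f ∘ σ) := Tuple.monotone_sort f
  refine ⟨σ, ?_, (Finset.univ.filter (fun j => σ j ∈ S)).sup (fun j => (j : ℕ) + 1), ?_, ?_⟩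
  · have hdesc : ∀ (i : Fin m) (h : (i : ℕ) + 1 < m), σ ⟨i + 1, h⟩ < σ i →
        σ i ∈ S ∧ σ ⟨i + 1, h⟩ ∉ S := by
      intro i h hlt
      have h1 : f (σ i) ≤ f (σ ⟨i + 1, h⟩) := hmono (by simp [Fin.le_def])
      have hlt' : (σ ⟨i + 1, h⟩ : ℕ) < σ i := hlt
      simp only [f] at h1
      split_ifs at h1 with h2 h3 h3
      · omega
      · exact ⟨h2, h3⟩
      · omega
      · omega
    have hnlt : ∀ i ∈ descents σ, ∀ j ∈ descents σ, ¬ i < j := by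
      intro i hi j hj hij
      obtain ⟨h, hi⟩ := mem_descents.1 hi
      obtain ⟨h', hj⟩ := mem_descents.1 hj
      exact (hdesc i h hi).2 (hmem (hmono (Fin.le_def.2 (Fin.lt_def.1 hij))) (hdesc j h' hj).1)
    exact Finset.card_le_one.2 fun i hi j hj =>
      le_antisymm (not_lt.1 (hnlt j hj i hi)) (not_lt.1 (hnlt i hi j hj))
  · exact Finset.sup_le fun j _ => j.2
  · intro j
    rw [Finset.lt_sup_iff]
    constructor
    · intro hj
      exact ⟨j, by simpa using hj, by simp⟩
    · rintro ⟨l, hl, hjl⟩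
      exact hmem (hmono (Fin.le_def.2 (Nat.lt_succ_iff.1 hjl))) (Finset.mem_filter.1 hl).2

lemma two_pow_le_eulerianNumber_one (m : ℕ) :
    2 ^ m ≤ (eulerianNumber m 1 + 1) * (m + 1) := by
  classical
  let P := Finset.univ.filter (fun σ : Equiv.Perm (Fin m) => (descents σ).card ≤ 1)
  have hP : P.card ≤ eulerianNumber m 1 + 1 := by
    suffices h : P.card ≤ eulerianNumber m 1 + eulerianNumber m 0 by
      rwa [eulerianNumber_zero] at h
    refine (Finset.card_le_card fun σ hσ => ?_).trans (Finset.card_union_le _ _)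
    simp only [P, Finset.mem_filter, Finset.mem_union, Finset.mem_univ, true_and] at hσ ⊢
    exact (Nat.le_one_iff_eq_zero_or_eq_one.1 hσ).symm
  let g : Equiv.Perm (Fin m) × ℕ → Finset (Fin m) :=
    fun x => Finset.univ.filter fun y => (x.1.symm y : ℕ) < x.2
  have hsurj : (Finset.univ : Finset (Finset (Fin m))) ⊆
      (P ×ˢ Finset.range (m + 1)).image g := by
    intro S _
    obtain ⟨σ, hσ, k, hk, h⟩ := exists_perm_descents_card_le_one S
    refine Finset.mem_image.2 ⟨(σ, k), ?_, ?_⟩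
    · simp [P, hσ, hk]
    · ext y
      simp [g, ← h]
  have := (Finset.card_le_card hsurj).trans Finset.card_image_le
  simp only [Finset.card_univ, Fintype.card_finset, Fintype.card_fin, Finset.card_product,
    Finset.card_range] at this
  exact this.trans (Nat.mul_le_mul_right _ hP)

/-- For a real polynomial with constant coefficient `1` all of whose complex roots are negative
reals, the linear coefficient is the sum of the absolute values of the inverses of the roots, and
is therefore controlled by the root closest to the origin. -/
lemma inv_le_coeff_one_and_coeff_one_le {p : ℝ[X]} (h0 : p.coeff 0 = 1) {a : ℝ} (ha : 0 < a)
    (hroot : p.eval (-a) = 0) (hmin : ∀ b : ℝ, 0 < b → p.eval (-b) = 0 → a ≤ b)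
    (hneg : ∀ z : ℂ, (p.map (algebraMap ℝ ℂ)).IsRoot z → ∃ r : ℝ, r < 0 ∧ z = (r : ℂ)) :
    a⁻¹ ≤ p.coeff 1 ∧ p.coeff 1 ≤ p.natDegree * a⁻¹ := by
  set q := p.map (algebraMap ℝ ℂ) with hq
  have hp : p ≠ 0 := by rintro rfl; simp at h0
  have hq0 : q ≠ 0 := (Polynomial.map_ne_zero_iff (algebraMap ℝ ℂ).injective).2 hp
  have hqe : q.eval 0 = 1 := by
    rw [← coeff_zero_eq_eval_zero, hq, coeff_map, h0, map_one]
  have hqd : q.derivative.eval 0 = (p.coeff 1 : ℂ) := by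
    rw [← coeff_zero_eq_eval_zero, coeff_derivative, hq, coeff_map]
    simp
  have heval : ∀ r : ℝ, q.eval (r : ℂ) = ((p.eval r : ℝ) : ℂ) := fun r => by
    rw [hq]
    exact (eval_map _ _).trans (eval₂_at_apply (algebraMap ℝ ℂ) r)
  have hsum := (IsAlgClosed.splits q).eval_derivative_div_eval_of_ne_zero (x := 0) (by simp [hqe])
  rw [hqe, hqd, div_one] at hsum
  have hsum' : p.coeff 1 = (q.roots.map fun z => (1 / (0 - z)).re).sum := by
    have := congrArg Complex.reAddGroupHom hsum
    rw [map_multiset_sum, Multiset.map_map] at this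
    simpa using this
  have hterm : ∀ x ∈ q.roots.map fun z => (1 / (0 - z)).re, 0 ≤ x ∧ x ≤ a⁻¹ := by
    intro x hx
    obtain ⟨z, hz, rfl⟩ := Multiset.mem_map.1 hx
    have hz := (mem_roots hq0).1 hz
    obtain ⟨r, hr, rfl⟩ := hneg z hz
    have hr' : p.eval (- -r) = 0 := by
      have h := hz.eq_zero
      rw [heval] at h
      rw [neg_neg]
      exact_mod_cast h
    have hle := hmin (-r) (by linarith) hr'
    have he : (1 / (0 - (r : ℂ))).re = (-r)⁻¹ := by
      rw [zero_sub, one_div, ← Complex.ofReal_neg, ← Complex.ofReal_inv, Complex.ofReal_re]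
    rw [he]
    exact ⟨inv_nonneg.2 (by linarith), inv_anti₀ ha hle⟩
  constructor
  · rw [hsum']
    refine Multiset.single_le_sum (fun x hx => (hterm x hx).1) _
      (Multiset.mem_map.2 ⟨(-a : ℝ), ?_, ?_⟩)
    · rw [mem_roots hq0, IsRoot, heval, hroot, Complex.ofReal_zero]
    · rw [zero_sub, one_div, ← Complex.ofReal_neg, ← Complex.ofReal_inv, Complex.ofReal_re, neg_neg]
  · rw [hsum']
    refine (Multiset.sum_le_card_nsmul _ _ fun x hx => (hterm x hx).2).trans ?_
    rw [nsmul_eq_mul, Multiset.card_map]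
    have : q.roots.card ≤ p.natDegree := by
      simpa [hq] using q.card_roots'
    gcongr

lemma tendsto_log_div_sub_one_atTop :
    Tendsto (fun n : ℕ => Real.log (n : ℝ) / ((n : ℝ) - 1)) atTop (nhds 0) := by
  have h1 : Tendsto (fun n : ℕ => Real.log (n : ℝ) / (1 * (n : ℝ) + (-1))) atTop (nhds 0) := by
    simpa [Function.comp_def] using
      (Real.tendsto_pow_log_div_mul_add_atTop 1 (-1) 1 one_ne_zero).comp
        tendsto_natCast_atTop_atTop
  simpa [sub_eq_add_neg] using h1

/-- If for each `n ≥ 2`, `−a_n` is the negative zero of `A_{2n}` closest to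
the origin and `A_{2n}` splits over `ℝ` with all zeros negative, then
`(1/(n−1)) · log a_n → −log 4`. -/
theorem stmt_10 (a : ℕ → ℝ)
    (hpos : ∀ n, 2 ≤ n → 0 < a n)
    (hroot : ∀ n, 2 ≤ n → (eulerianA (2 * n)).eval (-(a n)) = 0)
    (hmin : ∀ n, 2 ≤ n → ∀ b : ℝ, 0 < b → (eulerianA (2 * n)).eval (-b) = 0 → a n ≤ b)
    (hneg : ∀ n, 2 ≤ n → ∀ z : ℂ,
      ((eulerianA (2 * n)).map (algebraMap ℝ ℂ)).IsRoot z → ∃ r : ℝ, r < 0 ∧ z = (r : ℂ)) :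
    Tendsto (fun n : ℕ => (1 / ((n : ℝ) - 1)) * Real.log (a n)) atTop
      (nhds (-Real.log 4)) := by
  have hbound : ∀ n, 2 ≤ n → 0 ≤ Real.log (a n) + n * Real.log 4 ∧
      Real.log (a n) + n * Real.log 4 ≤ Real.log 12 + 2 * Real.log n := by
    intro n hn
    have ha := hpos n hn
    have hn1 : (2 : ℝ) ≤ n := by exact_mod_cast hn
    have h0 : (eulerianA (2 * n)).coeff 0 = 1 := by
      rw [coeff_eulerianA (by omega), eulerianNumber_zero, Nat.cast_one]
    obtain ⟨hlow, hupp⟩ := inv_le_coeff_one_and_coeff_one_le h0 ha (hroot n hn) (hmin n hn)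
      (hneg n hn)
    rw [coeff_eulerianA (by omega)] at hlow hupp
    have hdeg : ((eulerianA (2 * n)).natDegree : ℝ) ≤ 2 * n := by
      exact_mod_cast natDegree_eulerianA_le (2 * n)
    set c := eulerianNumber (2 * n) 1 with hc
    have hpow : (2 : ℝ) ^ (2 * n) = 4 ^ n := by rw [pow_mul]; norm_num
    have hc1 : (c : ℝ) ≤ 4 ^ n := by
      rw [← hpow]
      exact_mod_cast eulerianNumber_one_le (2 * n)
    have hc2 : (4 : ℝ) ^ n ≤ (c + 1) * (2 * n + 1) := by
      rw [← hpow]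
      exact_mod_cast two_pow_le_eulerianNumber_one (2 * n)
    have hcpos : (1 : ℝ) ≤ c := by
      have : (0 : ℝ) < c := (inv_pos.2 ha).trans_le hlow
      exact_mod_cast this
    have h4 : (4 : ℝ) ^ n ≠ 0 := by positivity
    have hlog : Real.log (a n) + n * Real.log 4 = Real.log (a n * 4 ^ n) := by
      rw [Real.log_mul ha.ne' h4, Real.log_pow]
    have hlog' : Real.log 12 + 2 * Real.log n = Real.log (12 * (n : ℝ) ^ 2) := by
      rw [Real.log_mul (by norm_num) (by positivity), Real.log_pow, Nat.cast_ofNat]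
    rw [hlog, hlog']
    constructor
    · refine Real.log_nonneg ?_
      calc (1 : ℝ) = a n * (a n)⁻¹ := (mul_inv_cancel₀ ha.ne').symm
        _ ≤ a n * 4 ^ n := by gcongr; exact hlow.trans hc1
    · refine Real.log_le_log (by positivity) ?_
      have hac : a n * c ≤ 2 * n := by
        calc a n * c ≤ a n * (2 * n * (a n)⁻¹) := by
              gcongr
              exact hupp.trans (by gcongr)
          _ = 2 * n := by field_simp
      calc a n * 4 ^ n ≤ a n * ((c + c) * (2 * n + n)) := by
            gcongr
            refine hc2.trans ?_
            gcongr
            linarith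
        _ = a n * c * (6 * n) := by ring
        _ ≤ 2 * n * (6 * n) := by gcongr
        _ = 12 * (n : ℝ) ^ 2 := by ring
  have hinv : Tendsto (fun n : ℕ => ((n : ℝ) - 1)⁻¹) atTop (nhds 0) :=
    tendsto_inv_atTop_zero.comp (tendsto_atTop_add_const_right _ (-1) tendsto_natCast_atTop_atTop)
  have hrem : Tendsto (fun n : ℕ => (Real.log (a n) + n * Real.log 4) * ((n : ℝ) - 1)⁻¹) atTop
      (nhds 0) := by
    have hup : Tendsto (fun n : ℕ => (Real.log 12 + 2 * Real.log n) * ((n : ℝ) - 1)⁻¹) atTop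
        (nhds 0) := by
      have := (hinv.const_mul (Real.log 12)).add (tendsto_log_div_sub_one_atTop.const_mul 2)
      rw [mul_zero, mul_zero, add_zero] at this
      refine this.congr fun n => ?_
      ring
    have hnonneg : ∀ n : ℕ, 2 ≤ n → (0 : ℝ) ≤ ((n : ℝ) - 1)⁻¹ := fun n hn => by
      have : (2 : ℝ) ≤ n := by exact_mod_cast hn
      exact inv_nonneg.2 (by linarith)
    refine tendsto_of_tendsto_of_tendsto_of_le_of_le' tendsto_const_nhds hup ?_ ?_
    · filter_upwards [eventually_ge_atTop 2] with n hn
      exact mul_nonneg (hbound n hn).1 (hnonneg n hn)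
    · filter_upwards [eventually_ge_atTop 2] with n hn
      exact mul_le_mul_of_nonneg_right (hbound n hn).2 (hnonneg n hn)
  have hmain := (hrem.sub (hinv.mul_const (Real.log 4))).sub_const (Real.log 4)
  rw [zero_mul, sub_zero, zero_sub] at hmain
  refine hmain.congr' ?_
  filter_upwards [eventually_ge_atTop 2] with n hn
  have hn1 : (n : ℝ) - 1 ≠ 0 := by
    have : (2 : ℝ) ≤ n := by exact_mod_cast hn
    linarith
  field_simp
  ring
end

section
/- For each n ≥ 2 let B_{2n−1} be a real polynomial satisfying the formal power series identity (B_{2n−1} viewed as a power series) = (1 − X)^{2n} · ∑_{k≥0} (2k+1)^{2n−1} X^k. Suppose there exists b_n > 0 with B_{2n−1}(−b_n) = 0, b_n ≤ b for every b > 0 with B_{2n−1}(−b) = 0, and such that every complex root of B_{2n−1} is a negative real number. Then (1/(n−1)) · log b_n → −log 9 as n → ∞. -/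
open Polynomial Filter

theorem PowerSeries.coeff_one_sub_X_pow_mul_mk (f : ℝ → ℝ) (N k : ℕ) :
    PowerSeries.coeff (k + N) ((1 - PowerSeries.X) ^ N * PowerSeries.mk fun i : ℕ => f i) =
      (fwdDiff (1 : ℝ))^[N] f k := by
  induction N generalizing k with
  | zero => simp
  | succ N ih =>
    rw [pow_succ', mul_assoc, sub_mul, one_mul, map_sub, ← add_assoc,
      PowerSeries.coeff_succ_X_mul, ih, add_right_comm, ih, Function.iterate_succ_apply', fwdDiff]
    push_cast
    rfl

theorem natDegree_lt_of_coe_eq {P : ℝ[X]} {N : ℕ} (Q : ℝ[X]) (hQ : Q.natDegree < N)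
    (hP : (P : PowerSeries ℝ) =
      (1 - PowerSeries.X) ^ N * PowerSeries.mk fun k : ℕ => Q.eval (k : ℝ)) :
    P.natDegree < N := by
  refine (Nat.le_sub_one_iff_lt (by omega)).1 (natDegree_le_iff_coeff_eq_zero.2 fun k hk => ?_)
  obtain ⟨j, rfl⟩ := Nat.exists_eq_add_of_le' (show N ≤ k by omega)
  rw [← Polynomial.coeff_coe, hP, PowerSeries.coeff_one_sub_X_pow_mul_mk (Q.eval ·),
    Polynomial.fwdDiff_iter_eq_zero_of_degree_lt hQ, Pi.zero_apply]

/-- If all complex roots of `P` are negative reals, `-β` is the one closest to the origin and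
`P(0) = 1`, then `β⁻¹` is comparable to the linear coefficient of `P`. -/
theorem inv_le_coeff_one_and_coeff_one_le_s12 {P : ℝ[X]} {β : ℝ} (hβ : 0 < β)
    (h0 : P.coeff 0 = 1) (hroot : P.eval (-β) = 0)
    (hmin : ∀ c : ℝ, 0 < c → P.eval (-c) = 0 → β ≤ c)
    (hneg : ∀ z : ℂ, (P.map (algebraMap ℝ ℂ)).IsRoot z → ∃ r : ℝ, r < 0 ∧ z = (r : ℂ)) :
    β⁻¹ ≤ P.coeff 1 ∧ P.coeff 1 ≤ P.natDegree * β⁻¹ := by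
  have hP : P ≠ 0 := by rintro rfl; simp at h0
  have hsplit : P.Splits := by
    refine Splits.of_splits_map (algebraMap ℝ ℂ) (IsAlgClosed.splits _) fun z hz => ?_
    obtain ⟨r, -, rfl⟩ := hneg z (isRoot_of_mem_roots hz)
    exact ⟨r, rfl⟩
  have hr : ∀ r ∈ P.roots, r < 0 := fun r hr => by
    obtain ⟨s, hs, h⟩ := hneg r ((isRoot_of_mem_roots hr).map (f := algebraMap ℝ ℂ))
    rwa [Complex.ofReal_inj.1 h]
  have hsum : P.coeff 1 = (P.roots.map fun z => 1 / (0 - z)).sum := by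
    have h0' : P.eval 0 = 1 := by rwa [← coeff_zero_eq_eval_zero]
    have := hsplit.eval_derivative_eq_eval_mul_sum (x := 0) (by simp [h0'])
    rw [h0', one_mul, ← coeff_zero_eq_eval_zero, coeff_derivative] at this
    simpa using this
  rw [hsum]
  constructor
  · have hmem : -β ∈ P.roots := (mem_roots hP).2 hroot
    have := Multiset.single_le_sum (s := P.roots.map fun z => 1 / (0 - z)) (fun x hx => by
      obtain ⟨r, hr', rfl⟩ := Multiset.mem_map.1 hx
      have := hr r hr'
      exact one_div_nonneg.2 (by linarith)) _ (Multiset.mem_map_of_mem _ hmem)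
    simpa using this
  · have := Multiset.sum_le_card_nsmul (P.roots.map fun z => 1 / (0 - z)) β⁻¹ (fun x hx => by
      obtain ⟨r, hr', rfl⟩ := Multiset.mem_map.1 hx
      have h := hr r hr'
      rw [zero_sub, one_div]
      refine inv_anti₀ hβ (hmin _ (by linarith) ?_)
      simpa using isRoot_of_mem_roots hr')
    rw [Multiset.card_map, nsmul_eq_mul] at this
    refine this.trans ?_
    gcongr
    exact P.card_roots'

theorem pow_le_three_pow_sub {n : ℕ} (hn : 2 ≤ n) :
    (9 : ℝ) ^ (n - 1) ≤ 3 ^ (2 * n - 1) - 2 * n := by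
  obtain ⟨k, rfl⟩ := Nat.exists_eq_add_of_le' (show 1 ≤ n by omega)
  have h := one_add_mul_le_pow (a := (8 : ℝ)) (by norm_num) k
  have h9 : (3 : ℝ) ^ (2 * (k + 1) - 1) = 3 * 9 ^ k := by
    rw [show 2 * (k + 1) - 1 = 2 * k + 1 by omega, pow_succ, pow_mul]; norm_num [mul_comm]
  rw [h9, Nat.add_sub_cancel]
  push_cast
  norm_num at h
  have : (0 : ℝ) ≤ k := k.cast_nonneg
  linarith

/-- For each `n ≥ 2` let `B_{2n−1}` be the real polynomial with
`(B_{2n−1} : ℝ⟦X⟧) = (1 − X)^{2n} · ∑_{k≥0} (2k+1)^{2n−1} X^k`. If `−b_n` is its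
negative zero closest to the origin, all complex roots being negative reals, then
`(1/(n−1)) · log b_n → −log 9`. -/
theorem stmt_12 (B : ℕ → Polynomial ℝ) (b : ℕ → ℝ)
    (hB : ∀ n, 2 ≤ n → (↑(B n) : PowerSeries ℝ) =
      (1 - PowerSeries.X) ^ (2 * n) *
        PowerSeries.mk (fun k : ℕ => ((2 * k + 1 : ℝ)) ^ (2 * n - 1)))
    (hpos : ∀ n, 2 ≤ n → 0 < b n)
    (hroot : ∀ n, 2 ≤ n → (B n).eval (-(b n)) = 0)
    (hmin : ∀ n, 2 ≤ n → ∀ c : ℝ, 0 < c → (B n).eval (-c) = 0 → b n ≤ c)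
    (hneg : ∀ n, 2 ≤ n → ∀ z : ℂ,
      ((B n).map (algebraMap ℝ ℂ)).IsRoot z → ∃ r : ℝ, r < 0 ∧ z = (r : ℂ)) :
    Tendsto (fun n : ℕ => (1 / ((n : ℝ) - 1)) * Real.log (b n)) atTop
      (nhds (-Real.log 9)) := by
  have hcoeff0 (n : ℕ) (hn : 2 ≤ n) : (B n).coeff 0 = 1 := by
    rw [← Polynomial.coeff_coe, hB n hn]
    simp
  have hcoeff1 (n : ℕ) (hn : 2 ≤ n) : (B n).coeff 1 = 3 ^ (2 * n - 1) - 2 * n := by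
    rw [← Polynomial.coeff_coe, hB n hn, PowerSeries.coeff_one_mul, PowerSeries.coeff_one_pow,
      ← PowerSeries.coeff_zero_eq_constantCoeff_apply,
      ← PowerSeries.coeff_zero_eq_constantCoeff_apply]
    simp [PowerSeries.coeff_one]
    norm_num
    ring
  have hdeg (n : ℕ) (hn : 2 ≤ n) : (B n).natDegree ≤ 2 * n := by
    refine (natDegree_lt_of_coe_eq ((C 2 * X + C 1) ^ (2 * n - 1)) ?_ ?_).le
    · refine natDegree_pow_le.trans_lt ?_
      have : (C 2 * X + C 1 : ℝ[X]).natDegree ≤ 1 := natDegree_linear_le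
      calc _ ≤ (2 * n - 1) * 1 := Nat.mul_le_mul_left _ this
        _ < 2 * n := by omega
    · rw [hB n hn]
      simp
  have hbounds (n : ℕ) (hn : 2 ≤ n) :
      -Real.log 9 - Real.log 3 / ((n : ℝ) - 1) ≤ 1 / ((n : ℝ) - 1) * Real.log (b n) ∧
      1 / ((n : ℝ) - 1) * Real.log (b n) ≤ -Real.log 9 + Real.log (2 * n) / ((n : ℝ) - 1) := by
    obtain ⟨h1, h2⟩ := inv_le_coeff_one_and_coeff_one_le_s12 (hpos n hn) (hcoeff0 n hn) (hroot n hn)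
      (hmin n hn) (hneg n hn)
    rw [hcoeff1 n hn] at h1 h2
    have hb := inv_pos.2 (hpos n hn)
    have hn' : (2 : ℝ) ≤ n := by exact_mod_cast hn
    have hm : (0 : ℝ) < n - 1 := by linarith
    have hcast : ((n - 1 : ℕ) : ℝ) = n - 1 := by push_cast [show 1 ≤ n by omega]; rfl
    have hupper : (b n)⁻¹ ≤ 3 * 9 ^ (n - 1) := by
      have : (3 : ℝ) ^ (2 * n - 1) = 3 * 9 ^ (n - 1) := by
        rw [show 2 * n - 1 = 2 * (n - 1) + 1 by omega, pow_succ, pow_mul]; norm_num [mul_comm]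
      linarith
    have hlower : (9 : ℝ) ^ (n - 1) ≤ 2 * n * (b n)⁻¹ := by
      refine (pow_le_three_pow_sub hn).trans (h2.trans ?_)
      gcongr
      exact_mod_cast hdeg n hn
    have hlu := Real.log_le_log hb hupper
    have hll := Real.log_le_log (by positivity) hlower
    rw [Real.log_mul (by norm_num) (by positivity), Real.log_pow, Real.log_inv, hcast] at hlu
    rw [Real.log_mul (by positivity) hb.ne', Real.log_pow, Real.log_inv, hcast] at hll
    constructor
    · rw [← sub_nonneg]
      have : 1 / ((n : ℝ) - 1) * Real.log (b n) - (-Real.log 9 - Real.log 3 / ((n : ℝ) - 1)) =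
          (Real.log (b n) + (n - 1) * Real.log 9 + Real.log 3) / (n - 1) := by
        field_simp; ring
      rw [this]
      exact div_nonneg (by linarith) hm.le
    · rw [← sub_nonneg]
      have : -Real.log 9 + Real.log (2 * n) / ((n : ℝ) - 1) - 1 / ((n : ℝ) - 1) * Real.log (b n) =
          (Real.log (2 * n) - (n - 1) * Real.log 9 - Real.log (b n)) / (n - 1) := by
        field_simp; ring
      rw [this]
      exact div_nonneg (by linarith) hm.le
  have hlog : Tendsto (fun n : ℕ => Real.log (2 * n) / ((n : ℝ) - 1)) atTop (nhds 0) := by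
    have := (Real.tendsto_pow_log_div_mul_add_atTop (1 / 2) (-1) 1 (by norm_num)).comp
      (tendsto_natCast_atTop_atTop.const_mul_atTop (two_pos (α := ℝ)))
    refine this.congr fun n => ?_
    simp only [Function.comp_apply, pow_one]
    congr 1
    ring
  have hconst : Tendsto (fun n : ℕ => Real.log 3 / ((n : ℝ) - 1)) atTop (nhds 0) :=
    (tendsto_atTop_add_const_right _ (-1) tendsto_natCast_atTop_atTop).const_div_atTop _
  refine tendsto_of_tendsto_of_tendsto_of_le_of_le'
    (by simpa using hconst.const_sub (-Real.log 9)) (by simpa using hlog.const_add (-Real.log 9))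
    ?_ ?_
  · filter_upwards [eventually_ge_atTop 2] with n hn using (hbounds n hn).1
  · filter_upwards [eventually_ge_atTop 2] with n hn using (hbounds n hn).2
end
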